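/- arXiv:1007.1359 — 2 statements merged into one kernel-verified Lean document; each statement's English description precedes it below -/
import Mathlib

section
/- There is an absolute constant C such that the following holds. Let T > 0, let v ∈ C⁰([−T,T], L²(T)), and let w ∈ C⁰([−T,T], H¹(T)) be a solution of the equation w_t − w_{xxt} + w_x + w w_x + (vw)_x = 0 with w(0) = w₀ ∈ H¹(T). Then for all t ∈ [0,T], ‖w(t)‖_{H¹(T)} ≤ ‖w₀‖_{H¹(T)} exp(C ∫₀ᵗ ‖v(τ)‖_{L²(T)} dτ). -/
open scoped BigOperators ComplexConjugate
open Complex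

noncomputable section

namespace BBM

/-!  We work on the torus `𝕋 = ℝ/2πℤ` at the level of Fourier coefficients: a function
`u` on `𝕋` is identified with its sequence of Fourier coefficients `û : ℤ → ℂ`
(`u(x) = Σ_k û(k) e^{ikx}`).  The product of two functions corresponds to the convolution
of their Fourier coefficients, and the Sobolev space `H^s(𝕋)` to the weighted `ℓ²` space
with weight `⟨k⟩^{2s} = (1+k²)^s`. -/

/-- Sobolev weight `⟨k⟩^{2s} = (1+k²)^s`. -/
def wt (s : ℝ) (k : ℤ) : ℝ := (1 + (k : ℝ) ^ 2) ^ s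

/-- `u ∈ H^s(𝕋)`: square-summability of the Fourier coefficients against `⟨k⟩^{2s}`. -/
def MemHs (s : ℝ) (u : ℤ → ℂ) : Prop :=
  Summable fun k : ℤ => wt s k * ‖u k‖ ^ 2

/-- The `H^s(𝕋)` norm, `‖u‖_{H^s} = (Σ_k ⟨k⟩^{2s} |û(k)|²)^{1/2}`. -/
def hsNorm (s : ℝ) (u : ℤ → ℂ) : ℝ :=
  Real.sqrt (∑' k : ℤ, wt s k * ‖u k‖ ^ 2)

/-- The symbol `φ(k) = k/(1+k²)` of the Fourier multiplier `φ(D)`. -/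
def phiSymb (k : ℤ) : ℝ := (k : ℝ) / (1 + (k : ℝ) ^ 2)

/-- The Fourier multiplier `φ(D)`, `(φ(D)u)^(k) = φ(k) û(k)`. -/
def phiD (u : ℤ → ℂ) : ℤ → ℂ := fun k => (phiSymb k : ℂ) * u k

/-- Fourier coefficients of the pointwise product `uv`: the convolution `û * v̂`. -/
def prodHat (u v : ℤ → ℂ) : ℤ → ℂ := fun k => ∑' l : ℤ, u l * v (k - l)

/-- Fourier coefficients of the free evolution `e^{-itφ(D)}u`. -/
def freeEvol (t : ℝ) (u : ℤ → ℂ) : ℤ → ℂ :=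
  fun k => Complex.exp (-Complex.I * t * phiSymb k) * u k

/-- `u` is the sequence of Fourier coefficients of a real-valued function. -/
def IsRealSeq (u : ℤ → ℂ) : Prop := ∀ k : ℤ, u (-k) = conj (u k)

/-- The Duhamel (integral) form of the BBM equation at time `t`:
`u(t) = e^{-itφ(D)}u₀ - (i/2) ∫₀ᵗ e^{-i(t-τ)φ(D)} φ(D)(u(τ)²) dτ`, coefficientwise. -/
def SolvesBBM (u₀ : ℤ → ℂ) (u : ℝ → ℤ → ℂ) (t : ℝ) : Prop :=
  ∀ k : ℤ, u t k = freeEvol t u₀ k -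
    (Complex.I / 2) * ∫ τ in (0:ℝ)..t,
      Complex.exp (-Complex.I * (t - τ) * phiSymb k) * (phiSymb k : ℂ) *
        prodHat (u τ) (u τ) k

/-- `u ∈ C⁰([-T,T], H^s(𝕋))`: membership in `H^s` at every time together with continuity
in time with respect to the `H^s` norm. -/
def ContHs (s T : ℝ) (u : ℝ → ℤ → ℂ) : Prop :=
  (∀ t ∈ Set.Icc (-T) T, MemHs s (u t)) ∧
  ∀ t₀ ∈ Set.Icc (-T) T, ∀ ε : ℝ, 0 < ε → ∃ δ : ℝ, 0 < δ ∧
    ∀ t ∈ Set.Icc (-T) T, |t - t₀| < δ →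
      hsNorm s (fun k => u t k - u t₀ k) < ε

/-- `u` is a solution of the BBM equation in `X^s_T = C⁰([-T,T], H^s(𝕋))` with initial
data `u₀`. -/
def IsSolOn (s T : ℝ) (u₀ : ℤ → ℂ) (u : ℝ → ℤ → ℂ) : Prop :=
  ContHs s T u ∧ ∀ t ∈ Set.Icc (-T) T, SolvesBBM u₀ u t


/-- The Duhamel (integral) form of the perturbed equation
`w_t - w_{xxt} + w_x + w w_x + (vw)_x = 0` at time `t`:
`w(t) = e^{-itφ(D)}w₀ - (i/2) ∫₀ᵗ e^{-i(t-τ)φ(D)} φ(D)(2 v(τ)w(τ) + w(τ)²) dτ`. -/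
def SolvesPerturbedBBM (v : ℝ → ℤ → ℂ) (w₀ : ℤ → ℂ) (w : ℝ → ℤ → ℂ) (t : ℝ) : Prop :=
  ∀ k : ℤ, w t k = freeEvol t w₀ k -
    (Complex.I / 2) * ∫ τ in (0:ℝ)..t,
      Complex.exp (-Complex.I * (t - τ) * phiSymb k) * (phiSymb k : ℂ) *
        (2 * prodHat (v τ) (w τ) k + prodHat (w τ) (w τ) k)

/-- The Hilbert space of square-summable sequences. -/
abbrev L2 := lp (fun _ : ℤ => ℂ) 2

theorem hasSum_cg {f g : ℤ → ℂ} {a : ℂ} (h : ∀ k, f k = g k) : HasSum f a ↔ HasSum g a := by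
  rw [funext h]

theorem two_pos' : 0 < (2 : ENNReal).toReal := by norm_num

theorem L2_norm_sq (x : L2) : ‖x‖ ^ 2 = ∑' k, ‖x k‖ ^ 2 := by
  have := lp.norm_rpow_eq_tsum two_pos' x
  simpa using this

theorem L2_norm (x : L2) : ‖x‖ = Real.sqrt (∑' k, ‖x k‖ ^ 2) := by
  rw [← L2_norm_sq, Real.sqrt_sq (norm_nonneg _)]

theorem memL2 {f : ℤ → ℂ} (h : Summable fun k => ‖f k‖ ^ 2) : Memℓp f 2 := by
  apply memℓp_gen
  simpa using h

theorem L2_summable (x : L2) : Summable fun k => ‖x k‖ ^ 2 := by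
  have := (lp.memℓp x).summable two_pos'
  simpa using this

/-- build an element -/
def mkL2 (f : ℤ → ℂ) (h : Summable fun k => ‖f k‖ ^ 2) : L2 := ⟨f, memL2 h⟩

@[simp] theorem mkL2_apply (f : ℤ → ℂ) (h) (k : ℤ) : mkL2 f h k = f k := rfl

theorem L2_ext {x y : L2} (h : ∀ k, x k = y k) : x = y := lp.ext (funext h)

theorem diag_aux (m : ℤ → ℝ) (hm : ∀ k, |m k| ≤ 1) (x : L2) (k : ℤ) :
    ‖(m k : ℂ) * x k‖ ≤ ‖x k‖ := by
  rw [norm_mul, Complex.norm_real, Real.norm_eq_abs]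
  exact mul_le_of_le_one_left (norm_nonneg _) (hm k)

/-- Fourier multipliers bounded by one. -/
def diag (m : ℤ → ℝ) (hm : ∀ k, |m k| ≤ 1) : L2 →L[ℂ] L2 :=
  LinearMap.mkContinuous
    { toFun := fun x => mkL2 (fun k => (m k : ℂ) * x k)
        (Summable.of_nonneg_of_le (fun _ => by positivity)
          (fun k => by gcongr; exact diag_aux m hm x k) (L2_summable x))
      map_add' := fun x y => L2_ext fun k => by simp [mul_add]
      map_smul' := fun c x => L2_ext fun k => by simp; ring }
    1 (fun x => by
      rw [one_mul]
      apply lp.norm_mono (by norm_num)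
      intro k
      exact diag_aux m hm x k)

@[simp] theorem diag_apply (m : ℤ → ℝ) (hm : ∀ k, |m k| ≤ 1) (x : L2) (k : ℤ) :
    diag m hm x k = (m k : ℂ) * x k := rfl

theorem diag_norm_le (m : ℤ → ℝ) (hm : ∀ k, |m k| ≤ 1) (x : L2) : ‖diag m hm x‖ ≤ ‖x‖ := by
  apply lp.norm_mono (by norm_num)
  intro k
  exact diag_aux m hm x k

theorem inner_L2 (x y : L2) : inner ℂ x y = ∑' k, conj (x k) * y k := by
  rw [lp.inner_eq_tsum]
  congr 1; ext k; simp [mul_comm]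

theorem diag_symm (m : ℤ → ℝ) (hm : ∀ k, |m k| ≤ 1) (x y : L2) :
    inner ℂ (diag m hm x) y = inner ℂ x (diag m hm y) := by
  rw [inner_L2, inner_L2]
  congr 1; ext k; simp; ring

/-- translations -/
def shift (n : ℤ) (x : L2) : L2 :=
  mkL2 (fun k => x (k - n)) ((Equiv.subRight n).summable_iff.mpr (L2_summable x))

@[simp] theorem shift_apply (n : ℤ) (x : L2) (k : ℤ) : shift n x k = x (k - n) := rfl

theorem shift_norm (n : ℤ) (x : L2) : ‖shift n x‖ = ‖x‖ := by
  rw [L2_norm, L2_norm]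
  congr 1
  exact (Equiv.subRight n).tsum_eq (fun k => ‖x k‖ ^ 2)

theorem shift_inner (n : ℤ) (x y : L2) : inner ℂ (shift n x) y = inner ℂ x (shift (-n) y) := by
  rw [inner_L2, inner_L2]
  rw [← (Equiv.subRight n).tsum_eq (fun k => conj (x k) * (shift (-n) y) k)]
  simp

/-- `1/⟨k⟩` -/
def jb (k : ℤ) : ℝ := (Real.sqrt (1 + (k : ℝ) ^ 2))⁻¹

theorem sq_pos' (k : ℤ) : 0 < Real.sqrt (1 + (k : ℝ) ^ 2) := Real.sqrt_pos.mpr (by positivity)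

theorem jb_pos (k : ℤ) : 0 < jb k := inv_pos.mpr (sq_pos' k)

theorem jb_sq (k : ℤ) : jb k ^ 2 = (1 + (k : ℝ) ^ 2)⁻¹ := by
  rw [jb, inv_pow, Real.sq_sqrt (by positivity)]

theorem jb_le (k : ℤ) : |jb k| ≤ 1 := by
  rw [abs_of_pos (jb_pos k)]
  apply inv_le_one_of_one_le₀
  rw [Real.one_le_sqrt]; nlinarith [sq_nonneg (k : ℝ)]

theorem kjb_le (k : ℤ) : |(k : ℝ) * jb k| ≤ 1 := by
  rw [← sq_le_one_iff_abs_le_one, mul_pow, jb_sq, ← div_eq_mul_inv, div_le_one (by positivity)]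
  linarith

theorem phi_eq (k : ℤ) : phiSymb k = k * jb k * jb k := by
  rw [mul_assoc, ← sq, jb_sq, phiSymb, div_eq_mul_inv]

theorem phi_le (k : ℤ) : |phiSymb k| ≤ 1 := by
  rw [phi_eq, abs_mul]
  exact mul_le_one₀ (kjb_le k) (abs_nonneg _) (jb_le k)

theorem jb_summable : Summable fun k : ℤ => ‖(jb k : ℂ)‖ ^ 2 := by
  have h : Summable fun k : ℤ => |(k : ℝ)| ^ (-2 : ℝ) := Real.summable_abs_int_rpow (by norm_num)
  apply Summable.of_norm_bounded_eventually h
  rw [Filter.eventually_cofinite]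
  apply (Set.finite_singleton (0 : ℤ)).subset
  intro k hk
  by_contra hk0
  apply hk
  simp only [Set.mem_singleton_iff] at hk0
  have : 0 < |(k : ℝ)| := abs_pos.mpr (by exact_mod_cast hk0)
  rw [Complex.norm_real, Real.norm_eq_abs, Real.norm_eq_abs, abs_pow, abs_abs, sq_abs, jb_sq,
    Real.rpow_neg this.le, Real.rpow_two, sq_abs]
  apply inv_anti₀
  · rw [← sq_abs]; positivity
  · linarith

/-- `1/⟨k⟩` as an `ℓ²` sequence -/
def jvec : L2 := mkL2 (fun k => (jb k : ℂ)) jb_summable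

theorem l1_bound (x : L2) : (Summable fun m => ‖(jb m : ℂ) * x m‖) ∧
    ∑' m, ‖(jb m : ℂ) * x m‖ ≤ ‖jvec‖ * ‖x‖ := by
  have := lp.tsum_mul_le_mul_norm (p := 2) (q := 2) (by
    rw [Real.holderConjugate_iff]; norm_num) jvec x
  simpa only [jvec, mkL2_apply, norm_mul] using this

theorem conv_summable (x y : L2) : Summable fun m => ((jb m : ℂ) * x m) • shift m y := by
  apply Summable.of_norm
  simp only [norm_smul, shift_norm]
  exact (l1_bound x).1.mul_right _

/-- multiplication of an `H¹` function by an `L²` function -/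
def cv (x y : L2) : L2 := ∑' m, ((jb m : ℂ) * x m) • shift m y

theorem cv_hasSum (x y : L2) (k : ℤ) :
    HasSum (fun m => (jb m : ℂ) * x m * y (k - m)) (cv x y k) := by
  have := (conv_summable x y).hasSum.mapL (lp.evalCLM ℂ (fun _ : ℤ => ℂ) 2 k)
  exact this

theorem cv_apply (x y : L2) (k : ℤ) : cv x y k = ∑' m, (jb m : ℂ) * x m * y (k - m) :=
  (cv_hasSum x y k).tsum_eq.symm

theorem cv_norm (x y : L2) : ‖cv x y‖ ≤ ‖jvec‖ * ‖x‖ * ‖y‖ := by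
  have h := l1_bound x
  have hs : Summable fun m => ‖((jb m : ℂ) * x m) • shift m y‖ := by
    simp only [norm_smul, shift_norm]
    exact h.1.mul_right _
  refine (norm_tsum_le_tsum_norm hs).trans ?_
  simp only [norm_smul, shift_norm]
  rw [tsum_mul_right]
  gcongr
  exact h.2

/-- bundled -/
def CV : L2 →L[ℂ] L2 →L[ℂ] L2 :=
  LinearMap.mkContinuous₂ (LinearMap.mk₂ ℂ cv
    (fun x x' y => L2_ext fun k => by
      refine (cv_hasSum (x + x') y k).unique ?_
      refine (hasSum_cg fun m => ?_).mp ((cv_hasSum x y k).add (cv_hasSum x' y k))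
      simp; ring)
    (fun c x y => L2_ext fun k => by
      refine (cv_hasSum (c • x) y k).unique ?_
      refine (hasSum_cg fun m => ?_).mp ((cv_hasSum x y k).mul_left c)
      simp; ring)
    (fun x y y' => L2_ext fun k => by
      refine (cv_hasSum x (y + y') k).unique ?_
      refine (hasSum_cg fun m => ?_).mp ((cv_hasSum x y k).add (cv_hasSum x y' k))
      simp; ring)
    (fun c x y => L2_ext fun k => by
      refine (cv_hasSum x (c • y) k).unique ?_
      refine (hasSum_cg fun m => ?_).mp ((cv_hasSum x y k).mul_left c)
      simp; ring)) ‖jvec‖ cv_norm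

theorem cv_continuous {f g : ℝ → L2} (hf : Continuous f) (hg : Continuous g) :
    Continuous fun t => cv (f t) (g t) := by
  have : Continuous fun t => CV (f t) (g t) := by fun_prop
  exact this

theorem cv_symm (x : L2) (hx : IsRealSeq x) (y z : L2) :
    inner ℂ (cv x y) z = inner ℂ y (cv x z) := by
  have h1 := (conv_summable x y).hasSum.mapL ((innerSL ℂ z))
  have h2 := (conv_summable x z).hasSum.mapL ((innerSL ℂ y))
  have h3 := ((Equiv.neg ℤ).hasSum_iff.mpr h2).map (starRingEnd ℂ) Complex.continuous_conj
  have : inner ℂ z (cv x y) = conj (inner ℂ y (cv x z)) := by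
    refine h1.unique ?_
    refine (hasSum_cg fun m => ?_).mp h3
    have e : jb (-m) = jb m := by simp [jb]
    simp only [Function.comp, innerSL_apply_apply, inner_smul_right, Equiv.neg_apply, map_mul,
      Complex.conj_ofReal, e, hx m, Complex.conj_conj, inner_conj_symm]
    rw [shift_inner, neg_neg]
  rw [← inner_conj_symm, this, Complex.conj_conj]

/-- `x ↦ w` -/
abbrev Jop : L2 →L[ℂ] L2 := diag jb jb_le
/-- `x ↦ -i w_x` -/
abbrev Dop : L2 →L[ℂ] L2 := diag (fun k => (k : ℝ) * jb k) kjb_le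

theorem cv_leibniz (x : L2) (k : ℤ) :
    (k : ℂ) * cv x (Jop x) k = 2 * cv x (Dop x) k := by
  have h1 := cv_hasSum x (Dop x) k
  have h2 := (Equiv.subLeft k).hasSum_iff.mpr h1
  have h3 := (cv_hasSum x (Jop x) k).mul_left (k : ℂ)
  refine h3.unique ?_
  rw [two_mul]
  refine (hasSum_cg fun m => ?_).mp (h1.add h2)
  simp
  ring

theorem cubic_zero (x : L2) (hx : IsRealSeq x) :
    inner ℂ (Dop x) (cv x (Jop x)) = 0 := by
  have h : inner ℂ (Dop x) (cv x (Jop x)) = 2 * inner ℂ (Jop x) (cv x (Dop x)) := by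
    rw [inner_L2, inner_L2, ← tsum_mul_left]
    congr 1; ext k
    have := cv_leibniz x k
    simp only [diag_apply, map_mul, Complex.conj_ofReal, Complex.ofReal_mul, Complex.ofReal_intCast, map_intCast] at *
    linear_combination (jb k * conj (x k)) * this
  rw [← cv_symm x hx (Jop x), ← inner_conj_symm (cv x (Jop x))] at h
  have h2 := congrArg (fun z => ‖z‖) h
  simp only [norm_mul, RCLike.norm_conj] at h2
  norm_num at h2
  rw [← norm_eq_zero]
  linarith

theorem wt_one (k : ℤ) (z : ℂ) : ‖((Real.sqrt (1 + (k : ℝ) ^ 2) : ℝ) : ℂ) * z‖ ^ 2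
    = wt 1 k * ‖z‖ ^ 2 := by
  rw [norm_mul, mul_pow, Complex.norm_real, Real.norm_eq_abs, sq_abs, Real.sq_sqrt (by positivity),
    wt, Real.rpow_one]

theorem wt_zero (k : ℤ) (z : ℂ) : wt 0 k * ‖z‖ ^ 2 = ‖z‖ ^ 2 := by
  rw [wt, Real.rpow_zero, one_mul]

/-- `H¹` sequence to `ℓ²` -/
def lift1 (u : ℤ → ℂ) (h : MemHs 1 u) : L2 :=
  mkL2 (fun k => ((Real.sqrt (1 + (k : ℝ) ^ 2) : ℝ) : ℂ) * u k) (by simp only [wt_one]; exact h)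

/-- `L²` sequence to `ℓ²` -/
def lift0 (u : ℤ → ℂ) (h : MemHs 0 u) : L2 :=
  mkL2 u (by have h' := h; simp only [MemHs, wt_zero] at h'; exact h')

theorem lift1_apply (u : ℤ → ℂ) (h : MemHs 1 u) (k : ℤ) :
    lift1 u h k = ((Real.sqrt (1 + (k : ℝ) ^ 2) : ℝ) : ℂ) * u k := rfl

theorem lift0_apply (u : ℤ → ℂ) (h : MemHs 0 u) (k : ℤ) : lift0 u h k = u k := rfl

theorem jb_lift1 (u : ℤ → ℂ) (h : MemHs 1 u) (k : ℤ) : (jb k : ℂ) * lift1 u h k = u k := by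
  rw [lift1_apply, ← mul_assoc, ← Complex.ofReal_mul, jb, inv_mul_cancel₀ (sq_pos' k).ne']
  simp

theorem lift1_norm (u : ℤ → ℂ) (h : MemHs 1 u) : ‖lift1 u h‖ = hsNorm 1 u := by
  rw [L2_norm, hsNorm]
  simp only [lift1_apply, wt_one]

theorem lift0_norm (u : ℤ → ℂ) (h : MemHs 0 u) : ‖lift0 u h‖ = hsNorm 0 u := by
  rw [L2_norm, hsNorm]
  simp only [lift0_apply, wt_zero]

theorem lift1_dist (u u' : ℤ → ℂ) (h : MemHs 1 u) (h' : MemHs 1 u') :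
    dist (lift1 u h) (lift1 u' h') = hsNorm 1 (fun k => u k - u' k) := by
  rw [dist_eq_norm, L2_norm, hsNorm]
  simp only [lp.coeFn_sub, Pi.sub_apply, lift1_apply, ← mul_sub, wt_one]

theorem lift0_dist (u u' : ℤ → ℂ) (h : MemHs 0 u) (h' : MemHs 0 u') :
    dist (lift0 u h) (lift0 u' h') = hsNorm 0 (fun k => u k - u' k) := by
  rw [dist_eq_norm, L2_norm, hsNorm]
  simp only [lp.coeFn_sub, Pi.sub_apply, lift0_apply, wt_zero]

/-- clamp -/
def clamp (T t : ℝ) : ℝ := max (-T) (min T t)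

theorem clamp_mem {T : ℝ} (hT : 0 < T) (t : ℝ) : clamp T t ∈ Set.Icc (-T) T :=
  ⟨le_max_left _ _, max_le (by linarith) (min_le_left _ _)⟩

theorem clamp_eq {T t : ℝ} (ht : t ∈ Set.Icc (-T) T) : clamp T t = t := by
  rw [clamp, min_eq_right ht.2, max_eq_right ht.1]

theorem clamp_cont (T : ℝ) : Continuous (clamp T) := by unfold clamp; fun_prop

theorem clamp_continuous {s T : ℝ} (hT : 0 < T) {u : ℝ → ℤ → ℂ} (hu : ContHs s T u)
    (L : (x : ℤ → ℂ) → MemHs s x → L2)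
    (hL : ∀ x y hx hy, dist (L x hx) (L y hy) = hsNorm s (fun k => x k - y k)) :
    Continuous fun t => L (u (clamp T t)) (hu.1 _ (clamp_mem hT t)) := by
  rw [Metric.continuous_iff]
  intro t₀ ε hε
  obtain ⟨δ, hδ, h⟩ := hu.2 _ (clamp_mem hT t₀) ε hε
  obtain ⟨η, hη, h'⟩ := Metric.continuous_iff.mp (clamp_cont T) t₀ δ hδ
  refine ⟨η, hη, fun t ht => ?_⟩
  rw [hL]
  exact h _ (clamp_mem hT t) (h' t ht)

theorem scalar_ode (φ : ℝ) (n : ℝ → ℂ) (hn : Continuous n) (w0 : ℂ) (y : ℝ → ℂ)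
    (hy : y = fun t : ℝ => Complex.exp (-Complex.I * t * φ) * w0 -
      (Complex.I / 2) * ∫ τ in (0:ℝ)..t, Complex.exp (-Complex.I * (t - τ) * φ) * (φ : ℂ) * n τ)
    (t : ℝ) : HasDerivAt y (-Complex.I * φ * y t - (Complex.I / 2) * (φ * n t)) t := by
  have e : y = fun t : ℝ => Complex.exp (-Complex.I * t * φ) * (w0 -
      (Complex.I / 2) * ∫ τ in (0:ℝ)..t, Complex.exp (Complex.I * τ * φ) * ((φ : ℂ) * n τ)) := by
    rw [hy]; ext t
    rw [mul_sub, mul_left_comm _ (Complex.I / 2), 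
      ← intervalIntegral.integral_const_mul (Complex.exp (-Complex.I * t * φ))]
    congr 2
    apply intervalIntegral.integral_congr
    intro τ _
    simp only
    rw [← mul_assoc, ← Complex.exp_add, mul_assoc]
    congr 2; ring
  have hc : Continuous fun τ : ℝ => Complex.exp (Complex.I * τ * φ) * ((φ : ℂ) * n τ) := by
    fun_prop
  have h1 : HasDerivAt (fun t : ℝ => ∫ τ in (0:ℝ)..t,
      Complex.exp (Complex.I * τ * φ) * ((φ : ℂ) * n τ)) _ t :=
    intervalIntegral.integral_hasDerivAt_right (hc.intervalIntegrable _ _)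
      (hc.stronglyMeasurableAtFilter _ _) hc.continuousAt
  have h2 : HasDerivAt (fun t : ℝ => Complex.exp (-Complex.I * t * φ))
      (Complex.exp (-Complex.I * t * φ) * (-Complex.I * 1 * φ)) t :=
    (((Complex.ofRealCLM.hasDerivAt (x := t)).const_mul (-Complex.I)).mul_const (φ : ℂ)).cexp
  have h3 := h2.mul ((h1.const_mul (Complex.I / 2)).const_sub w0)
  rw [e]
  refine h3.congr_deriv ?_
  have : Complex.exp (-Complex.I * t * φ) * Complex.exp (Complex.I * t * φ) = 1 := by
    rw [← Complex.exp_add]; simp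
  linear_combination (-Complex.I / 2 * φ * n t) * this

/-- right-hand side of the ODE -/
def rhs (x v : L2) : L2 :=
  (-Complex.I) • diag phiSymb phi_le x -
    (Complex.I / 2) • Dop ((2 : ℂ) • cv x v + cv x (Jop x))

theorem energy (x v : L2) (hx : IsRealSeq x) :
    2 * (inner ℂ x (rhs x v)).re ≤ 2 * (‖jvec‖ * ‖v‖) * ‖x‖ ^ 2 := by
  have h1 : (inner ℂ x (diag phiSymb phi_le x)).im = 0 := by
    have := inner_conj_symm (𝕜 := ℂ) x (diag phiSymb phi_le x)
    rw [diag_symm] at this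
    exact Complex.conj_eq_iff_im.mp this
  have h2 : ‖inner ℂ (Dop x) (cv x v)‖ ≤ ‖x‖ * (‖jvec‖ * ‖x‖ * ‖v‖) := by
    refine (norm_inner_le_norm (𝕜 := ℂ) _ _).trans ?_
    gcongr
    · exact diag_norm_le _ _ _
    · exact cv_norm _ _
  have h3 : inner ℂ x (rhs x v) = -Complex.I * inner ℂ x (diag phiSymb phi_le x)
      - Complex.I * inner ℂ (Dop x) (cv x v) := by
    rw [rhs, inner_sub_right, inner_smul_right, inner_smul_right, ← diag_symm _ _ x ((2 : ℂ) • cv x v + cv x (Jop x)), inner_add_right,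
      inner_smul_right, cubic_zero x hx]
    ring
  rw [h3]
  have h4 := (Complex.abs_im_le_norm (inner ℂ (Dop x) (cv x v))).trans h2
  have h5 := (abs_le.mp h4).2
  simp only [Complex.sub_re, Complex.mul_re, Complex.neg_re, Complex.neg_im, Complex.I_re,
    Complex.I_im, h1]
  nlinarith

theorem rhs_continuous {f g : ℝ → L2} (hf : Continuous f) (hg : Continuous g) :
    Continuous fun t => rhs (f t) (g t) := by
  have h1 := cv_continuous hf hg
  have h2 := cv_continuous hf (Jop.continuous.comp hf)
  simp only [Function.comp_def] at h2
  unfold rhs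
  fun_prop

theorem gronwall (E E' a : ℝ → ℝ) (T C : ℝ) (ha : Continuous a)
    (hE : ∀ t, HasDerivAt E (E' t) t) (h : ∀ t ∈ Set.Icc 0 T, E' t ≤ 2 * (C * a t) * E t)
    (t : ℝ) (ht : t ∈ Set.Icc 0 T) :
    E t ≤ E 0 * Real.exp (2 * (C * ∫ τ in (0:ℝ)..t, a τ)) := by
  have hA : ∀ t, HasDerivAt (fun t => ∫ τ in (0:ℝ)..t, a τ) (a t) t := fun t =>
    intervalIntegral.integral_hasDerivAt_right (ha.intervalIntegrable _ _)
      (ha.stronglyMeasurableAtFilter _ _) ha.continuousAt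
  set A : ℝ → ℝ := fun t => ∫ τ in (0:ℝ)..t, a τ with hAdef
  have hF : ∀ t, HasDerivAt (fun t => E t * Real.exp (-(2 * (C * A t))))
      (E' t * Real.exp (-(2 * (C * A t))) +
        E t * (Real.exp (-(2 * (C * A t))) * -(2 * (C * a t)))) t := fun t =>
    (hE t).mul ((((hA t).const_mul C).const_mul 2).neg.exp)
  have anti : AntitoneOn (fun t => E t * Real.exp (-(2 * (C * A t)))) (Set.Icc 0 T) := by
    apply antitoneOn_of_deriv_nonpos (convex_Icc 0 T)
    · exact fun t _ => (hF t).continuousAt.continuousWithinAt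
    · exact fun t _ => (hF t).differentiableAt.differentiableWithinAt
    · intro t ht
      rw [(hF t).deriv]
      have := h t (interior_subset ht)
      have := Real.exp_pos (-(2 * (C * A t)))
      nlinarith
  have h0 : (0:ℝ) ∈ Set.Icc 0 T := ⟨le_rfl, ht.1.trans ht.2⟩
  have := anti h0 ht ht.1
  have hA0 : A 0 = 0 := by simp [hAdef]
  simp only [hA0, mul_zero, neg_zero, Real.exp_zero, mul_one] at this
  rw [Real.exp_neg, ← div_eq_mul_inv, div_le_iff₀ (Real.exp_pos _)] at this
  exact this
/-- A priori `H¹` bound: there is an absolute constant `C` such that any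
solution `w ∈ C⁰([-T,T], H¹(𝕋))` of `w_t - w_{xxt} + w_x + w w_x + (vw)_x = 0` with
`v ∈ C⁰([-T,T], L²(𝕋))` (all real-valued) and `w(0) = w₀ ∈ H¹(𝕋)` satisfies
`‖w(t)‖_{H¹} ≤ ‖w₀‖_{H¹} exp(C ∫₀ᵗ ‖v(τ)‖_{L²} dτ)` for `0 ≤ t ≤ T`. -/
theorem apriori_H1_bound :
    ∃ C : ℝ, 0 < C ∧ ∀ T : ℝ, 0 < T → ∀ v w : ℝ → ℤ → ℂ, ∀ w₀ : ℤ → ℂ,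
      ContHs 0 T v → (∀ t ∈ Set.Icc (-T) T, IsRealSeq (v t)) →
      MemHs 1 w₀ → IsRealSeq w₀ →
      ContHs 1 T w → (∀ t ∈ Set.Icc (-T) T, IsRealSeq (w t)) →
      (∀ t ∈ Set.Icc (-T) T, SolvesPerturbedBBM v w₀ w t) →
      ∀ t ∈ Set.Icc (0:ℝ) T,
        hsNorm 1 (w t) ≤ hsNorm 1 w₀ *
          Real.exp (C * ∫ τ in (0:ℝ)..t, hsNorm 0 (v τ)) := by
  refine ⟨‖jvec‖ + 1, by positivity, ?_⟩
  intro T hT v w w₀ hv hvr hw₀ hw₀r hw hwr hsol t ht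
  have mem0 : ∀ {τ : ℝ}, τ ∈ Set.Icc 0 T → τ ∈ Set.Icc (-T) T := fun h => ⟨by linarith [h.1], h.2⟩
  have hWc := clamp_continuous hT hw lift1 lift1_dist
  have hVc := clamp_continuous hT hv lift0 lift0_dist
  set W : ℝ → L2 := fun t => lift1 (w (clamp T t)) (hw.1 _ (clamp_mem hT t)) with hW
  set V : ℝ → L2 := fun t => lift0 (v (clamp T t)) (hv.1 _ (clamp_mem hT t)) with hV
  have hWr : ∀ t, IsRealSeq (W t) := by
    intro t k
    have := hwr _ (clamp_mem hT t) k
    simp only [hW, lift1_apply, this, map_mul, Complex.conj_ofReal]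
    simp
  have hHc := rhs_continuous hWc hVc
  set N : ℝ → L2 := fun t => (2 : ℂ) • cv (W t) (V t) + cv (W t) (Jop (W t)) with hN
  have hNc : Continuous N := by
    have h1 := cv_continuous hWc hVc
    have h2 := cv_continuous hWc (Jop.continuous.comp hWc)
    exact (h1.const_smul (2 : ℂ)).add h2
  have hNk : ∀ τ ∈ Set.Icc (-T) T, ∀ k,
      2 * prodHat (v τ) (w τ) k + prodHat (w τ) (w τ) k = N τ k := by
    intro τ hτ k
    simp only [hN, lp.coeFn_add, lp.coeFn_smul, Pi.add_apply, Pi.smul_apply, cv_apply, smul_eq_mul,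
      diag_apply, hW, hV, jb_lift1, lift0_apply, clamp_eq hτ, prodHat]
    congr 2
    rw [← (Equiv.subLeft k).tsum_eq (fun m => w τ m * v τ (k - m))]
    simp [mul_comm]
  -- integral form in L2
  have hint : ∀ t ∈ Set.Icc 0 T, W t = lift1 w₀ hw₀ + ∫ τ in (0:ℝ)..t, rhs (W τ) (V τ) := by
    intro t ht
    apply L2_ext
    intro k
    have hNkc : Continuous fun τ => N τ k :=
      (lp.evalCLM ℂ (fun _ : ℤ => ℂ) 2 k).continuous.comp hNc
    set y : ℝ → ℂ := fun t : ℝ => Complex.exp (-Complex.I * t * phiSymb k) * w₀ k -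
      (Complex.I / 2) * ∫ τ in (0:ℝ)..t,
        Complex.exp (-Complex.I * (t - τ) * phiSymb k) * (phiSymb k : ℂ) * N τ k with hy
    have hode := scalar_ode (phiSymb k) (fun τ => N τ k) hNkc (w₀ k) y hy
    have hyw : ∀ s ∈ Set.Icc 0 T, w s k = y s := by
      intro s hs
      rw [hsol s (mem0 hs) k, hy, freeEvol]
      simp only
      congr 2
      apply intervalIntegral.integral_congr
      intro τ hτ
      rw [Set.uIcc_of_le hs.1] at hτ
      simp only
      rw [hNk τ (mem0 ⟨hτ.1, hτ.2.trans hs.2⟩)]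
    have hyc : Continuous y := continuous_iff_continuousAt.mpr fun s => (hode s).continuousAt
    have hftc := intervalIntegral.integral_eq_sub_of_hasDerivAt (a := 0) (b := t)
      (fun s _ => hode s) (Continuous.intervalIntegrable (by fun_prop) _ _)
    have hy0 : y 0 = w₀ k := by simp [hy]
    have hc := (lp.evalCLM ℂ (fun _ : ℤ => ℂ) 2 k).intervalIntegral_comp_comm
      (hHc.intervalIntegrable (μ := MeasureTheory.volume) 0 t)
    have hc' : (∫ τ in (0:ℝ)..t, rhs (W τ) (V τ) : L2) k
        = ∫ τ in (0:ℝ)..t, (rhs (W τ) (V τ)) k := hc.symm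
    rw [lp.coeFn_add, Pi.add_apply, hc']
    have hsq : ((Real.sqrt (1 + (k : ℝ) ^ 2) : ℝ) : ℂ) * (jb k : ℂ) = 1 := by
      rw [← Complex.ofReal_mul, jb, mul_inv_cancel₀ (sq_pos' k).ne', Complex.ofReal_one]
    have hcg : ∫ τ in (0:ℝ)..t, (rhs (W τ) (V τ)) k = ∫ τ in (0:ℝ)..t,
        ((Real.sqrt (1 + (k : ℝ) ^ 2) : ℝ) : ℂ) *
          (-Complex.I * phiSymb k * y τ - (Complex.I / 2) * (phiSymb k * N τ k)) := by
      apply intervalIntegral.integral_congr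
      intro τ hτ
      rw [Set.uIcc_of_le ht.1] at hτ
      have hτ' : τ ∈ Set.Icc 0 T := ⟨hτ.1, hτ.2.trans ht.2⟩
      have hWk : W τ k = ((Real.sqrt (1 + (k : ℝ) ^ 2) : ℝ) : ℂ) * y τ := by
        rw [← hyw τ hτ', hW]
        simp only [lift1_apply, clamp_eq (mem0 hτ')]
      have hr : rhs (W τ) (V τ) k = -Complex.I * (phiSymb k * W τ k)
          - (Complex.I / 2) * (((k * jb k : ℝ) : ℂ) * N τ k) := rfl
      simp only
      rw [hr, hWk, phi_eq]
      push_cast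
      linear_combination (-(Complex.I / 2) * (k * jb k) * N τ k) * (-hsq)
    rw [hcg, intervalIntegral.integral_const_mul, hftc, hy0, ← hyw t ht, lift1_apply]
    simp only [hW, lift1_apply, clamp_eq (mem0 ht)]
    ring
  set Z : ℝ → L2 := fun t => lift1 w₀ hw₀ + ∫ τ in (0:ℝ)..t, rhs (W τ) (V τ) with hZ
  have hZd : ∀ t, HasDerivAt Z (rhs (W t) (V t)) t := fun t =>
    (intervalIntegral.integral_hasDerivAt_right (hHc.intervalIntegrable _ _)
      (hHc.stronglyMeasurableAtFilter _ _) hHc.continuousAt).const_add _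
  have hEd : ∀ t, HasDerivAt (fun t => ‖Z t‖ ^ 2) (2 * (inner ℂ (Z t) (rhs (W t) (V t))).re) t := by
    intro t
    have h := (Complex.reCLM.hasFDerivAt.comp_hasDerivAt t ((hZd t).inner ℂ (hZd t)))
    have e1 : (fun t => ‖Z t‖ ^ 2) = (Complex.reCLM ∘ fun t => inner ℂ (Z t) (Z t)) := by
      ext t
      simp only [Function.comp, Complex.reCLM_apply]
      rw [inner_self_eq_norm_sq_to_K]
      norm_cast
    rw [e1]
    refine h.congr_deriv ?_
    rw [Complex.reCLM_apply, Complex.add_re, ← inner_conj_symm (rhs (W t) (V t)) (Z t),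
      Complex.conj_re]
    ring
  have hg := gronwall _ _ (fun t => ‖V t‖) T (‖jvec‖ + 1) hVc.norm hEd (by
    intro s hs
    have := energy (W s) (V s) (hWr s)
    rw [← show W s = Z s from hint s hs]
    refine this.trans ?_
    gcongr
    linarith) t ht
  have hZ0 : Z 0 = lift1 w₀ hw₀ := by simp [hZ]
  have hI : ∫ τ in (0:ℝ)..t, ‖V τ‖ = ∫ τ in (0:ℝ)..t, hsNorm 0 (v τ) := by
    apply intervalIntegral.integral_congr
    intro τ hτ
    rw [Set.uIcc_of_le ht.1] at hτ
    simp only [hV, lift0_norm, clamp_eq (mem0 ⟨hτ.1, hτ.2.trans ht.2⟩)]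
  have hZt : ‖Z t‖ = hsNorm 1 (w t) := by
    rw [← show W t = Z t from hint t ht]
    simp only [hW, lift1_norm, clamp_eq (mem0 ht)]
  simp only [hZ0, hI, hZt, lift1_norm] at hg
  have hn : ∀ u, 0 ≤ hsNorm 1 u := fun u => Real.sqrt_nonneg _
  refine (sq_le_sq₀ (hn _) ?_).mp ?_
  · exact (mul_nonneg (hn _) (Real.exp_pos _).le)
  rw [mul_pow, ← Real.exp_nat_mul]
  exact_mod_cast hg

end BBM
end
end

section
/- For each T > 0 and each s > 0, the flow map Φ : H^s(T) → X^s_T = C⁰([−T,T], H^s(T)) of the BBM equation, u₀ ↦ u, is real-analytic. -/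
open scoped BigOperators ComplexConjugate ENNReal
open Complex

noncomputable section

namespace BBMFlow

/-!  We work on the torus `𝕋 = ℝ/2πℤ` at the level of Fourier coefficients.  The Sobolev
space `H^s(𝕋)` of real-valued functions is isometrically identified with the space
`realSub` of sequences `v ∈ ℓ²(ℤ, ℂ)` with `v(-k) = conj (v k)`, an element `v` representing
the function with Fourier coefficients `û(k) = ⟨k⟩^{-s} v(k)`, `⟨k⟩ = (1+k²)^{1/2}`;
then `‖v‖_{ℓ²} = ‖u‖_{H^s}` and the reality condition on `û` is equivalent to that on `v`.
The space `X^s_T = C⁰([-T,T], H^s(𝕋))` is then `C(Set.Icc (-T) T, realSub)` with its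
sup-norm.  The pointwise product corresponds to convolution of Fourier coefficients. -/

/-- The sequence space `ℓ²(ℤ, ℂ)`, regarded as a real normed space. -/
abbrev SeqLp : Type := lp (fun _ : ℤ => ℂ) 2

/-- The (real) subspace of sequences satisfying the reality condition `v(-k) = conj v(k)`,
which models real-valued functions. -/
def realSub : Submodule ℝ SeqLp where
  carrier := {v : SeqLp | ∀ k : ℤ, v (-k) = conj (v k)}
  add_mem' := by
    intro a b ha hb k
    simp only [lp.coeFn_add, Pi.add_apply, Set.mem_setOf_eq] at *
    rw [ha k, hb k, map_add]
  zero_mem' := by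
    intro k
    simp [lp.coeFn_zero]
  smul_mem' := by
    intro c v hv k
    simp only [lp.coeFn_smul, Pi.smul_apply, Set.mem_setOf_eq] at *
    rw [hv k]
    simp [Complex.real_smul, map_mul]

/-- The Fourier coefficient `û(k) = ⟨k⟩^{-s} v(k)` of the `H^s` function represented by
`v ∈ realSub`. -/
def coeffAt (s : ℝ) (v : realSub) (k : ℤ) : ℂ :=
  (((1 + (k : ℝ) ^ 2) ^ (-(s / 2)) : ℝ) : ℂ) * (v : SeqLp) k

/-- The symbol `φ(k) = k/(1+k²)` of the Fourier multiplier `φ(D)`. -/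
def phiSymb (k : ℤ) : ℝ := (k : ℝ) / (1 + (k : ℝ) ^ 2)

/-- The Fourier coefficients, extended by `0` outside `[-T,T]`, of a curve
`U ∈ C⁰([-T,T], H^s(𝕋))`. -/
def uc (s T : ℝ) (U : C(Set.Icc (-T) T, realSub)) (τ : ℝ) (k : ℤ) : ℂ :=
  if h : τ ∈ Set.Icc (-T) T then coeffAt s (U ⟨τ, h⟩) k else 0

/-- `U ∈ X^s_T = C⁰([-T,T], H^s(𝕋))` solves the BBM integral equation
`u(t) = e^{-itφ(D)}u₀ - (i/2) ∫₀ᵗ e^{-i(t-τ)φ(D)} φ(D)(u(τ)²) dτ` with initial data `u₀`,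
written coefficientwise (the Fourier coefficients of `u(τ)²` being the convolution square
of those of `u(τ)`). -/
def IsBBMSol (s T : ℝ) (u₀ : realSub) (U : C(Set.Icc (-T) T, realSub)) : Prop :=
  ∀ t ∈ Set.Icc (-T) T, ∀ k : ℤ,
    uc s T U t k = Complex.exp (-Complex.I * t * phiSymb k) * coeffAt s u₀ k -
      (Complex.I / 2) * ∫ τ in (0:ℝ)..t,
        Complex.exp (-Complex.I * (t - τ) * phiSymb k) * ((phiSymb k : ℝ) : ℂ) *
          ∑' l : ℤ, uc s T U τ l * uc s T U τ (k - l)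


section Abstract
set_option linter.unusedSectionVars false
open Set
variable {E : Type*} [NormedAddCommGroup E] [NormedSpace ℝ E] {T : ℝ}

theorem neg_le_self_of_pos' (hT : 0 < T) : -T ≤ T := by linarith

theorem cont_ext (h : -T ≤ T) (W : C(Icc (-T) T, E)) :
    Continuous (fun τ : ℝ => W (projIcc (-T) T h τ)) :=
  W.continuous.comp continuous_projIcc

/-- integration from zero -/
def Jop [CompleteSpace E] (h : -T ≤ T) : C(Icc (-T) T, E) →L[ℝ] C(Icc (-T) T, E) :=
  LinearMap.mkContinuous
    { toFun := fun W => ⟨fun t => ∫ τ in (0:ℝ)..t, W (projIcc (-T) T h τ),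
        (intervalIntegral.continuous_primitive
          (fun a b => (cont_ext h W).intervalIntegrable a b) 0).comp continuous_subtype_val⟩
      map_add' := by
        intro W V
        ext t
        simp only [ContinuousMap.coe_mk, ContinuousMap.add_apply]
        exact intervalIntegral.integral_add ((cont_ext h W).intervalIntegrable _ _)
          ((cont_ext h V).intervalIntegrable _ _)
      map_smul' := by
        intro c W
        ext t
        simp }
    T (by
      intro W
      have hT : 0 ≤ T := by linarith
      refine (ContinuousMap.norm_le _ (by positivity)).2 fun t => ?_
      simp only [LinearMap.coe_mk, AddHom.coe_mk, ContinuousMap.coe_mk]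
      refine (intervalIntegral.norm_integral_le_of_norm_le_const
        (C := ‖W‖) (fun x _ => W.norm_coe_le_norm _)).trans ?_
      rw [mul_comm]
      gcongr
      rw [sub_zero]
      exact abs_le.2 t.2)

theorem Jop_apply [CompleteSpace E] (h : -T ≤ T) (W : C(Icc (-T) T, E)) (t : Icc (-T) T) :
    Jop h W t = ∫ τ in (0:ℝ)..t, W (projIcc (-T) T h τ) := rfl

/-- pointwise bilinear map -/
def Bop (B : E →L[ℝ] E →L[ℝ] E) :
    C(Icc (-T) T, E) →L[ℝ] C(Icc (-T) T, E) →L[ℝ] C(Icc (-T) T, E) :=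
  LinearMap.mkContinuous₂
    (LinearMap.mk₂ ℝ (fun U V => (⟨fun t => B (U t) (V t), by fun_prop⟩ : C(Icc (-T) T, E)))
      (by intros; ext; simp) (by intros; ext; simp) (by intros; ext; simp) (by intros; ext; simp))
    ‖B‖ (by
      intro U V
      refine (ContinuousMap.norm_le _ (by positivity)).2 fun t => ?_
      simp only [LinearMap.mk₂_apply, ContinuousMap.coe_mk]
      refine (B.le_opNorm₂ _ _).trans ?_
      gcongr
      · exact U.norm_coe_le_norm _
      · exact V.norm_coe_le_norm _)

theorem Bop_apply (B : E →L[ℝ] E →L[ℝ] E) (U V : C(Icc (-T) T, E)) (t : Icc (-T) T) :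
    Bop B U V t = B (U t) (V t) := rfl

/-- pointwise linear map -/
def Aop (A : E →L[ℝ] E) : C(Icc (-T) T, E) →L[ℝ] C(Icc (-T) T, E) :=
  A.compLeftContinuous ℝ (Icc (-T) T)

theorem Aop_apply (A : E →L[ℝ] E) (U : C(Icc (-T) T, E)) (t : Icc (-T) T) :
    Aop A U t = A (U t) := rfl

theorem abs_integral_abs_pow (n : ℕ) (t : ℝ) :
    |∫ τ in (0:ℝ)..t, |τ| ^ n| = |t| ^ (n + 1) / (n + 1) := by
  rcases le_total 0 t with ht | ht
  · have : ∫ τ in (0:ℝ)..t, |τ| ^ n = ∫ τ in (0:ℝ)..t, τ ^ n := by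
      refine intervalIntegral.integral_congr fun x hx => ?_
      rw [uIcc_of_le ht] at hx
      simp only [abs_of_nonneg hx.1]
    rw [this, integral_pow, abs_of_nonneg ht]
    rw [abs_of_nonneg (by simp; positivity)]
    simp
  · have : ∫ τ in (0:ℝ)..t, |τ| ^ n = ∫ τ in (0:ℝ)..t, (-τ) ^ n := by
      refine intervalIntegral.integral_congr fun x hx => ?_
      rw [uIcc_of_ge ht] at hx
      simp only [abs_of_nonpos hx.2]
    rw [this, intervalIntegral.integral_comp_neg (fun x => x ^ n), integral_pow, abs_of_nonpos ht]
    have h0 : 0 ≤ -t := by linarith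
    rw [abs_of_nonpos]
    · simp; ring
    · simp
      apply div_nonpos_of_nonpos_of_nonneg
      · simp; positivity
      · positivity

theorem volterra_unit [CompleteSpace E] (h : -T ≤ T)
    (F : C(Icc (-T) T, E) →L[ℝ] C(Icc (-T) T, E)) (K : ℝ) (hK : 0 ≤ K)
    (hF : ∀ W t, ‖F W t‖ ≤ K * ‖W t‖) : IsUnit (1 - (Jop h).comp F) := by
  set L := (Jop h).comp F with hL
  have hT : 0 ≤ T := by linarith
  have key : ∀ n : ℕ, ∀ W : C(Icc (-T) T, E), ∀ t : Icc (-T) T,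
      ‖(L ^ n) W t‖ ≤ K ^ n * |(t:ℝ)| ^ n / n.factorial * ‖W‖ := by
    intro n
    induction n with
    | zero => intro W t; simpa using W.norm_coe_le_norm t
    | succ n ih =>
      intro W t
      rw [pow_succ']
      change ‖Jop h (F ((L ^ n) W)) t‖ ≤ _
      rw [Jop_apply]
      have h1 : ‖∫ τ in (0:ℝ)..t, F ((L ^ n) W) (projIcc (-T) T h τ)‖ ≤
          |∫ τ in (0:ℝ)..t, (K * (K ^ n / n.factorial * ‖W‖)) * |τ| ^ n| := by
        refine intervalIntegral.norm_integral_le_abs_of_norm_le ?_ ?_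
        · refine (MeasureTheory.ae_restrict_iff' measurableSet_uIoc).2 (Filter.Eventually.of_forall ?_)
          intro τ hτ
          refine (hF _ _).trans ?_
          rw [mul_assoc]
          refine mul_le_mul_of_nonneg_left ((ih W _).trans (le_of_eq ?_)) hK
          have hτ' : τ ∈ Icc (-T) T := by
            have h0 : (0:ℝ) ∈ Icc (-T) T := ⟨by linarith, hT⟩
            exact (uIcc_subset_Icc h0 t.2) (uIoc_subset_uIcc hτ)
          rw [projIcc_of_mem h hτ']
          ring
        · exact (by fun_prop : Continuous fun τ : ℝ => (K * (K ^ n / n.factorial * ‖W‖)) * |τ| ^ n).intervalIntegrable _ _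
      refine h1.trans (le_of_eq ?_)
      rw [intervalIntegral.integral_const_mul, abs_mul, abs_integral_abs_pow,
        abs_of_nonneg (by positivity)]
      rw [Nat.factorial_succ]
      push_cast
      field_simp
      ring
  obtain ⟨n, hn⟩ : ∃ n : ℕ, (K * T) ^ n / n.factorial < 1 :=
    ((FloorSemiring.tendsto_pow_div_factorial_atTop (K * T)).eventually
      (gt_mem_nhds one_pos)).exists
  have hnorm : ‖L ^ n‖ < 1 := by
    refine lt_of_le_of_lt (ContinuousLinearMap.opNorm_le_bound _ (by positivity) fun W => ?_) hn
    refine (ContinuousMap.norm_le _ (by positivity)).2 fun t => (key n W t).trans ?_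
    rw [mul_pow]
    gcongr
    exact abs_le.2 t.2
  have hu : IsUnit (1 - L ^ n) := 
    isUnit_one_sub_of_norm_lt_one (R := C(Icc (-T) T, E) →L[ℝ] C(Icc (-T) T, E)) hnorm
  have hc : Commute (1 - L) (∑ i ∈ Finset.range n, L ^ i) :=
    Commute.sum_right _ _ _ fun i _ => ((Commute.one_left _).sub_left (Commute.self_pow L i))
  rw [← mul_neg_geom_sum] at hu
  exact (hc.isUnit_mul_iff.1 hu).1

theorem abstract_flow [CompleteSpace E] (h : -T ≤ T) (A : E →L[ℝ] E) (B : E →L[ℝ] E →L[ℝ] E)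
    (Φ : E → C(Icc (-T) T, E))
    (hΦ : ∀ u t, Φ u t = u + ∫ τ in (0:ℝ)..t, (A (Φ u (projIcc (-T) T h τ)) +
      B (Φ u (projIcc (-T) T h τ)) (Φ u (projIcc (-T) T h τ)))) :
    AnalyticOnNhd ℝ Φ univ := by
  let X := C(Icc (-T) T, E)
  let G : X → X := fun U => U - Jop h (Aop A U + Bop B U U)
  let S : E →L[ℝ] X := ContinuousLinearMap.const ℝ (Icc (-T) T)
  have hGS : ∀ u, G (Φ u) = S u := by
    intro u
    ext t
    change Φ u t - Jop h (Aop A (Φ u) + Bop B (Φ u) (Φ u)) t = u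
    rw [Jop_apply, hΦ u t]
    simp only [ContinuousMap.add_apply, Aop_apply, Bop_apply]
    abel
  let F : X → X → (X →L[ℝ] X) := fun U V => Aop A + Bop B U + (Bop B).flip V
  have hunit : ∀ U V, IsUnit (1 - (Jop h).comp (F U V)) := by
    intro U V
    refine volterra_unit h _ (‖A‖ + ‖B‖ * ‖U‖ + ‖B‖ * ‖V‖) (by positivity) ?_
    intro W t
    change ‖A (W t) + B (U t) (W t) + B (W t) (V t)‖ ≤ _
    refine (norm_add₃_le).trans ?_
    have h1 := A.le_opNorm (W t)
    have h2 := B.le_opNorm₂ (U t) (W t)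
    have h3 := B.le_opNorm₂ (W t) (V t)
    have h4 : ‖B‖ * ‖U t‖ * ‖W t‖ ≤ ‖B‖ * ‖U‖ * ‖W t‖ := by
      gcongr; exact U.norm_coe_le_norm t
    have h5 : ‖B‖ * ‖W t‖ * ‖V t‖ ≤ ‖B‖ * ‖W t‖ * ‖V‖ := by
      gcongr; exact V.norm_coe_le_norm t
    nlinarith
  have hinj : Function.Injective G := by
    intro U V hUV
    obtain ⟨a, ha⟩ := hunit U V
    have h0 : (1 - (Jop h).comp (F U V)) (U - V) = 0 := by
      have : (1 - (Jop h).comp (F U V)) (U - V) = G U - G V := by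
        change (U - V) - Jop h (Aop A (U - V) + Bop B U (U - V) + Bop B (U - V) V) =
          (U - Jop h (Aop A U + Bop B U U)) - (V - Jop h (Aop A V + Bop B V V))
        have e : Aop A (U - V) + Bop B U (U - V) + Bop B (U - V) V =
            (Aop A U + Bop B U U) - (Aop A V + Bop B V V) := by
          simp only [map_sub, sub_apply]
          abel
        rw [e, map_sub]
        abel
      rw [this, hUV, sub_self]
    have h1 : ((↑a⁻¹ : X →L[ℝ] X) * (↑a : X →L[ℝ] X)) (U - V) = 0 := by
      rw [ha, mul_apply_eq_comp, h0, map_zero]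
    rw [Units.inv_mul, one_apply_eq_self] at h1
    exact sub_eq_zero.1 h1
  have hGan : ∀ U, AnalyticAt ℝ G U := by
    intro U
    refine analyticAt_id.sub ?_
    refine ((Jop h).analyticAt _).comp (f := fun U => Aop A U + Bop B U U) (((Aop A).analyticAt _).add ?_)
    exact ((Bop B).analyticAt_bilinear (U, U)).comp (f := fun U => (U, U))
      (AnalyticAt.prod (analyticAt_id (𝕜 := ℝ) (z := U)) (analyticAt_id (𝕜 := ℝ) (z := U)))
  have hGd : ∀ U, HasFDerivAt G (1 - (Jop h).comp (F U U)) U := by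
    intro U
    have hb : HasFDerivAt (fun U => Bop B U U) (Bop B U + (Bop B).flip U) U := by
      have := (Bop B).hasFDerivAt_of_bilinear (hasFDerivAt_id U) (hasFDerivAt_id U)
      refine this.congr_fderiv ?_
      ext1 W
      simp [ContinuousLinearMap.precompR, ContinuousLinearMap.precompL]
    have := (hasFDerivAt_id U).sub ((Jop h).hasFDerivAt.comp U ((Aop A).hasFDerivAt.add hb))
    refine this.congr_fderiv ?_
    simp only [F, add_assoc]
    rfl
  intro u _
  obtain ⟨a, ha⟩ := hunit (Φ u) (Φ u)
  let e : X ≃L[ℝ] X := ContinuousLinearEquiv.ofUnit a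
  have hed : HasFDerivAt G (e : X →L[ℝ] X) (Φ u) := by
    have : (e : X →L[ℝ] X) = 1 - (Jop h).comp (F (Φ u) (Φ u)) := by rw [← ha]; rfl
    rw [this]; exact hGd _
  have hstrict : HasStrictFDerivAt G (e : X →L[ℝ] X) (Φ u) := by
    have := (hGan (Φ u)).hasStrictFDerivAt
    rwa [hed.fderiv] at this
  let R := hstrict.toOpenPartialHomeomorph G
  have hsrc : Φ u ∈ R.source := hstrict.mem_toOpenPartialHomeomorph_source
  have hRan : AnalyticAt ℝ R.symm (G (Φ u)) :=
    R.analyticAt_symm' hsrc (hGan (Φ u)) hed.fderiv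
  rw [hGS] at hRan
  have hcomp : AnalyticAt ℝ (fun v => R.symm (S v)) u := hRan.comp (S.analyticAt u)
  refine hcomp.congr ?_
  have htgt : R.target ∈ nhds (S u) := by
    rw [← hGS]
    exact R.open_target.mem_nhds (R.map_source hsrc)
  filter_upwards [S.continuous.continuousAt.preimage_mem_nhds htgt] with v hv
  apply hinj
  rw [hGS]
  exact R.right_inv hv

end Abstract

section Concrete

theorem phi_neg (k : ℤ) : phiSymb (-k) = - phiSymb k := by
  simp [phiSymb, neg_div]

theorem phi_abs_le (k : ℤ) : |phiSymb k| ≤ 1 := by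
  unfold phiSymb
  rw [abs_div, abs_of_pos (by positivity : (0:ℝ) < 1 + (k:ℝ)^2), div_le_one (by positivity)]
  nlinarith [sq_nonneg (|(k:ℝ)| - 1), sq_abs (k:ℝ), abs_nonneg (k:ℝ)]

theorem phi_summable : Summable (fun k : ℤ => (|phiSymb k|) ^ 2) := by
  refine Summable.of_nonneg_of_le (fun k => by positivity) (fun k => ?_)
    (Real.summable_one_div_int_pow (p := 2) |>.2 (by norm_num))
  rw [sq_abs]
  unfold phiSymb
  rcases eq_or_ne k 0 with rfl | hk
  · simp
  · have hk' : (k:ℝ) ≠ 0 := by exact_mod_cast hk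
    have : 0 < (k:ℝ)^2 := by positivity
    rw [div_pow, div_le_div_iff₀ (by positivity) this]
    nlinarith

theorem mk_mem {f : ℤ → ℂ} {g : ℤ → ℝ} (hfg : ∀ k, ‖f k‖ ≤ g k)
    (hg : Summable fun k => g k ^ 2) : Memℓp f 2 := by
  refine memℓp_gen ?_
  simp only [ENNReal.toReal_ofNat, Real.rpow_ofNat]
  exact Summable.of_nonneg_of_le (fun k => by positivity)
    (fun k => pow_le_pow_left₀ (norm_nonneg _) (hfg k) 2) hg

theorem mk_norm {v : SeqLp} {g : ℤ → ℝ} (hfg : ∀ k, ‖v k‖ ≤ g k)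
    (hg : Summable fun k => g k ^ 2) {C : ℝ} (hC : 0 ≤ C) (hgC : ∑' k, g k ^ 2 ≤ C ^ 2) :
    ‖v‖ ≤ C := by
  refine lp.norm_le_of_tsum_le (by norm_num) hC ?_
  simp only [ENNReal.toReal_ofNat, Real.rpow_ofNat]
  refine le_trans (Summable.tsum_le_tsum
    (fun k => pow_le_pow_left₀ (norm_nonneg _) (hfg k) 2) ?_ hg) hgC
  exact Summable.of_nonneg_of_le (fun k => by positivity)
    (fun k => pow_le_pow_left₀ (norm_nonneg _) (hfg k) 2) hg

theorem sq_summable (v : SeqLp) : Summable fun k => ‖v k‖ ^ 2 := by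
  have := (lp.memℓp v).summable (by norm_num)
  simpa using this

theorem sq_tsum (v : SeqLp) : ∑' k, ‖v k‖ ^ 2 = ‖v‖ ^ 2 := by
  have := lp.norm_rpow_eq_tsum (p := 2) (by norm_num) v
  simpa using this.symm

/-- coordinate evaluation -/
def ev (k : ℤ) : realSub →L[ℝ] ℂ :=
  (lp.evalCLM ℝ (fun _ : ℤ => ℂ) 2 k).comp realSub.subtypeL

theorem ev_apply (k : ℤ) (v : realSub) : ev k v = (v : SeqLp) k := rfl

theorem realSub_closed : IsClosed (realSub : Set SeqLp) := by
  have : (realSub : Set SeqLp) = ⋂ k : ℤ, {v : SeqLp |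
      lp.evalCLM ℝ (fun _ : ℤ => ℂ) 2 (-k) v = conj (lp.evalCLM ℝ (fun _ : ℤ => ℂ) 2 k v)} := by
    ext v
    simp only [Set.mem_iInter, Set.mem_ofPred_eq]
    rfl
  rw [this]
  refine isClosed_iInter fun k => isClosed_eq (ContinuousLinearMap.continuous _) ?_
  exact Complex.continuous_conj.comp (ContinuousLinearMap.continuous _)

instance : CompleteSpace realSub := realSub_closed.completeSpace_coe

/-- multiplication by the symbol `-iφ` -/
def Amul : realSub →L[ℝ] realSub :=
  LinearMap.mkContinuous
    { toFun := fun v => ⟨⟨fun k => -I * (phiSymb k : ℂ) * (v : SeqLp) k,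
        mk_mem (g := fun k => ‖(v : SeqLp) k‖) (fun k => by
          rw [norm_mul, norm_mul, norm_neg, norm_I, one_mul, Complex.norm_real, Real.norm_eq_abs]
          exact mul_le_of_le_one_left (norm_nonneg _) (phi_abs_le k)) (sq_summable _)⟩, by
        intro k
        change -I * (phiSymb (-k) : ℂ) * (v : SeqLp) (-k) =
          conj (-I * (phiSymb k : ℂ) * (v : SeqLp) k)
        rw [v.2 k, phi_neg]
        simp⟩
      map_add' := by
        intro v w
        ext k
        change -I * (phiSymb k : ℂ) * ((v : SeqLp) k + (w : SeqLp) k) =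
          -I * (phiSymb k : ℂ) * (v : SeqLp) k + -I * (phiSymb k : ℂ) * (w : SeqLp) k
        ring
      map_smul' := by
        intro c v
        ext k
        change -I * (phiSymb k : ℂ) * (c • (v : SeqLp) k) =
          c • (-I * (phiSymb k : ℂ) * (v : SeqLp) k)
        simp only [Complex.real_smul]
        ring }
    1 (by
      intro v
      rw [one_mul]
      refine mk_norm (g := fun k => ‖(v : SeqLp) k‖) (fun k => ?_) (sq_summable _)
        (norm_nonneg _) (sq_tsum _).le
      change ‖-I * (phiSymb k : ℂ) * (v : SeqLp) k‖ ≤ _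
      rw [norm_mul, norm_mul, norm_neg, norm_I, one_mul, Complex.norm_real, Real.norm_eq_abs]
      exact mul_le_of_le_one_left (norm_nonneg _) (phi_abs_le k))

theorem ev_Amul (k : ℤ) (v : realSub) : ev k (Amul v) = -I * (phiSymb k : ℂ) * ev k v := rfl

/-- weight -/
def wt (s : ℝ) (k : ℤ) : ℝ := (1 + (k : ℝ) ^ 2) ^ (s / 2)

theorem wt_pos (s : ℝ) (k : ℤ) : 0 < wt s k := by unfold wt; positivity

theorem coeffAt_eq (s : ℝ) (v : realSub) (k : ℤ) :
    coeffAt s v k = ((wt s k)⁻¹ : ℝ) * (v : SeqLp) k := by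
  unfold coeffAt wt
  rw [Real.rpow_neg (by positivity)]

theorem wt_neg (s : ℝ) (k : ℤ) : wt s (-k) = wt s k := by simp [wt]

theorem wt_peetre {s : ℝ} (hs : 0 < s) (k l : ℤ) :
    wt s k ≤ 2 ^ (s / 2) * wt s l * wt s (k - l) := by
  unfold wt
  rw [← Real.mul_rpow (by positivity) (by positivity),
    ← Real.mul_rpow (by positivity) (by positivity)]
  refine Real.rpow_le_rpow (by positivity) ?_ (by positivity)
  push_cast
  nlinarith [sq_nonneg ((l:ℝ) - (k - l)), sq_nonneg ((l:ℝ) * (k - l))]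

theorem cs_shift (a b : SeqLp) (k : ℤ) :
    (Summable fun l => ‖a l‖ * ‖b (k - l)‖) ∧ ∑' l, ‖a l‖ * ‖b (k - l)‖ ≤ ‖a‖ * ‖b‖ := by
  have hb : Summable fun l => ‖b (k - l)‖ ^ 2 :=
    (Equiv.subLeft k).summable_iff.2 (sq_summable b)
  have hb' : ∑' l, ‖b (k - l)‖ ^ 2 = ‖b‖ ^ 2 := by
    rw [← sq_tsum b]
    exact (Equiv.subLeft k).tsum_eq (fun l => ‖b l‖ ^ 2)
  have := Real.summable_and_inner_le_Lp_mul_Lq_tsum_of_nonneg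
    (Real.HolderConjugate.two_two) (f := fun l => ‖a l‖) (g := fun l => ‖b (k - l)‖)
    (fun _ => norm_nonneg _) (fun _ => norm_nonneg _)
    (by simpa using sq_summable a) (by simpa using hb)
  refine ⟨this.1, this.2.trans (le_of_eq ?_)⟩
  simp only [Real.rpow_ofNat, sq_tsum, hb']
  rw [← Real.sqrt_eq_rpow, ← Real.sqrt_eq_rpow, Real.sqrt_sq (norm_nonneg _),
    Real.sqrt_sq (norm_nonneg _)]

theorem cv_term_le {s : ℝ} (hs : 0 < s) (a b : realSub) (k l : ℤ) :
    ‖coeffAt s a l * coeffAt s b (k - l)‖ ≤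
      (2 ^ (s / 2) * (wt s k)⁻¹) * (‖(a : SeqLp) l‖ * ‖(b : SeqLp) (k - l)‖) := by
  rw [coeffAt_eq, coeffAt_eq, norm_mul, norm_mul, norm_mul, Complex.norm_real, Complex.norm_real,
    Real.norm_of_nonneg (inv_nonneg.2 (wt_pos s l).le),
    Real.norm_of_nonneg (inv_nonneg.2 (wt_pos s _).le)]
  have h1 : (wt s l)⁻¹ * (wt s (k - l))⁻¹ ≤ 2 ^ (s / 2) * (wt s k)⁻¹ := by
    have := wt_peetre hs k l
    have p1 := wt_pos s k
    have p2 := wt_pos s l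
    have p3 := wt_pos s (k - l)
    rw [← mul_inv, ← div_eq_mul_inv, inv_eq_one_div, div_le_div_iff₀ (by positivity) p1]
    linarith
  calc _ = ((wt s l)⁻¹ * (wt s (k - l))⁻¹) * (‖(a : SeqLp) l‖ * ‖(b : SeqLp) (k - l)‖) := by ring
    _ ≤ _ := by gcongr

/-- convolution -/
def cv (s : ℝ) (a b : realSub) (k : ℤ) : ℂ := ∑' l : ℤ, coeffAt s a l * coeffAt s b (k - l)

theorem cv_summable {s : ℝ} (hs : 0 < s) (a b : realSub) (k : ℤ) :
    Summable fun l : ℤ => coeffAt s a l * coeffAt s b (k - l) :=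
  Summable.of_norm_bounded ((cs_shift a b k).1.mul_left _) (cv_term_le hs a b k)

theorem cv_norm {s : ℝ} (hs : 0 < s) (a b : realSub) (k : ℤ) :
    ‖cv s a b k‖ ≤ (2 ^ (s / 2) * (wt s k)⁻¹) * (‖a‖ * ‖b‖) := by
  refine (tsum_of_norm_bounded ((cs_shift a b k).1.mul_left _).hasSum (cv_term_le hs a b k)).trans ?_
  rw [tsum_mul_left]
  have := wt_pos s k
  gcongr
  exact (cs_shift a b k).2

theorem coeffAt_neg (s : ℝ) (a : realSub) (k : ℤ) : coeffAt s a (-k) = conj (coeffAt s a k) := by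
  rw [coeffAt_eq, coeffAt_eq, a.2 k, wt_neg]
  simp

theorem cv_neg (s : ℝ) (a b : realSub) (k : ℤ) : cv s a b (-k) = conj (cv s a b k) := by
  unfold cv
  rw [conj_tsum, ← (Equiv.neg ℤ).tsum_eq]
  refine tsum_congr fun l => ?_
  rw [map_mul, ← coeffAt_neg, ← coeffAt_neg]
  congr 2
  simp; ring

theorem coeffAt_add (s : ℝ) (a b : realSub) (k : ℤ) :
    coeffAt s (a + b) k = coeffAt s a k + coeffAt s b k := by
  change _ * ((a : SeqLp) k + (b : SeqLp) k) = _
  unfold coeffAt; ring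

theorem coeffAt_smul (s : ℝ) (c : ℝ) (a : realSub) (k : ℤ) :
    coeffAt s (c • a) k = c * coeffAt s a k := by
  change _ * (c • (a : SeqLp) k) = _
  rw [Complex.real_smul]
  unfold coeffAt; ring

/-- coefficients of the bilinear term -/
def bcf (s : ℝ) (a b : realSub) (k : ℤ) : ℂ := -(I / 2) * (phiSymb k : ℂ) * (wt s k : ℂ) * cv s a b k

theorem bcf_norm {s : ℝ} (hs : 0 < s) (a b : realSub) (k : ℤ) :
    ‖bcf s a b k‖ ≤ (2 ^ (s / 2) * (‖a‖ * ‖b‖)) * |phiSymb k| := by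
  unfold bcf
  have hp := wt_pos s k
  rw [norm_mul, norm_mul, norm_mul, norm_neg, norm_div, norm_I, Complex.norm_real,
    Complex.norm_real, Real.norm_eq_abs, Real.norm_of_nonneg hp.le, Complex.norm_ofNat]
  calc _ ≤ 1 / 2 * |phiSymb k| * wt s k * ((2 ^ (s / 2) * (wt s k)⁻¹) * (‖a‖ * ‖b‖)) := by
        gcongr; exact cv_norm hs a b k
    _ = 1 / 2 * ((2 ^ (s / 2) * (‖a‖ * ‖b‖)) * |phiSymb k|) := by field_simp
    _ ≤ _ := by
      have : 0 ≤ (2 ^ (s / 2) * (‖a‖ * ‖b‖)) * |phiSymb k| := by positivity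
      linarith

theorem bcf_sq_summable (c : ℝ) : Summable fun k => (c * |phiSymb k|) ^ 2 := by
  simp only [mul_pow]
  exact phi_summable.mul_left _

/-- bilinear term as an element -/
def bel {s : ℝ} (hs : 0 < s) (a b : realSub) : realSub :=
  ⟨⟨bcf s a b, mk_mem (bcf_norm hs a b) (bcf_sq_summable _)⟩, by
    intro k
    change bcf s a b (-k) = conj (bcf s a b k)
    unfold bcf
    rw [cv_neg, phi_neg, wt_neg]
    simp only [map_mul, map_neg, map_div₀, conj_I, conj_ofReal, map_ofNat, ofReal_neg]
    ring⟩

theorem bel_apply {s : ℝ} (hs : 0 < s) (a b : realSub) (k : ℤ) :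
    (bel hs a b : SeqLp) k = bcf s a b k := rfl

/-- the bounded bilinear map -/
def Bmul {s : ℝ} (hs : 0 < s) : realSub →L[ℝ] realSub →L[ℝ] realSub :=
  LinearMap.mkContinuous₂
    (LinearMap.mk₂ ℝ (bel hs)
      (by
        intro a a' b
        ext k
        change bcf s (a + a') b k = bcf s a b k + bcf s a' b k
        simp only [bcf, cv, coeffAt_add, add_mul]
        rw [(cv_summable hs a b k).tsum_add (cv_summable hs a' b k)]
        ring)
      (by
        intro c a b
        ext k
        change bcf s (c • a) b k = c • bcf s a b k
        simp only [bcf, cv, coeffAt_smul, mul_assoc, tsum_mul_left, Complex.real_smul]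
        ring)
      (by
        intro a b b'
        ext k
        change bcf s a (b + b') k = bcf s a b k + bcf s a b' k
        simp only [bcf, cv, coeffAt_add, mul_add]
        rw [(cv_summable hs a b k).tsum_add (cv_summable hs a b' k)]
        ring)
      (by
        intro c a b
        ext k
        change bcf s a (c • b) k = c • bcf s a b k
        simp only [bcf, cv, coeffAt_smul, mul_left_comm _ (c : ℂ), tsum_mul_left,
          Complex.real_smul]))
    (2 ^ (s / 2) * Real.sqrt (∑' k, |phiSymb k| ^ 2)) (by
      intro a b
      rw [LinearMap.mk₂_apply]
      refine mk_norm (v := (bel hs a b : SeqLp)) (bcf_norm hs a b) (bcf_sq_summable _)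
        (by positivity) (le_of_eq ?_)
      simp only [mul_pow]
      rw [tsum_mul_left, Real.sq_sqrt (tsum_nonneg fun k => by positivity)]
      ring)

theorem ev_Bmul {s : ℝ} (hs : 0 < s) (a b : realSub) (k : ℤ) :
    ev k (Bmul hs a b) = bcf s a b k := rfl

theorem scalar_duhamel (p : ℂ) (b w : ℝ → ℂ) (w0 : ℂ) (hb : Continuous b) {T : ℝ} (hT : 0 < T)
    (hw : ∀ t ∈ Set.Icc (-T) T, w t = exp (p * t) * w0 +
      ∫ τ in (0:ℝ)..t, exp (p * (t - τ)) * b τ) :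
    ∀ t ∈ Set.Icc (-T) T, w t = w0 + ∫ τ in (0:ℝ)..t, (p * w τ + b τ) := by
  let h : ℝ → ℂ := fun τ => exp (-p * τ) * b τ
  have hc : Continuous h := by fun_prop
  let z : ℝ → ℂ := fun t => exp (p * t) * (w0 + ∫ τ in (0:ℝ)..t, h τ)
  have hwz : ∀ t ∈ Set.Icc (-T) T, w t = z t := by
    intro t ht
    rw [hw t ht]
    simp only [z, h]
    rw [mul_add, ← intervalIntegral.integral_const_mul]
    congr 1
    refine intervalIntegral.integral_congr fun τ _ => ?_
    rw [← mul_assoc, ← exp_add]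
    congr 2
    ring
  have hz : ∀ t, HasDerivAt z (p * z t + b t) t := by
    intro t
    have h1 : HasDerivAt (fun t : ℝ => exp (p * t)) (exp (p * t) * p) t := by
      have := ((hasDerivAt_id (t:ℂ)).const_mul p).cexp.comp_ofReal
      simpa using this
    have h2 : HasDerivAt (fun t => w0 + ∫ τ in (0:ℝ)..t, h τ) (h t) t :=
      (intervalIntegral.integral_hasDerivAt_right (hc.intervalIntegrable _ _)
        (hc.stronglyMeasurableAtFilter _ _) hc.continuousAt).const_add w0
    refine (h1.mul h2).congr_deriv ?_
    simp only [z, h]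
    have : exp (p * t) * (exp (-p * t) * b t) = b t := by
      rw [← mul_assoc, ← exp_add]; simp
    rw [this]; ring
  have hzc : Continuous z := continuous_iff_continuousAt.2 fun t => (hz t).continuousAt
  intro t ht
  have hft := intervalIntegral.integral_eq_sub_of_hasDerivAt (a := 0) (b := t) (fun x _ => hz x)
    ((by fun_prop : Continuous fun t => p * z t + b t).intervalIntegrable _ _)
  have hz0 : z 0 = w0 := by simp [z]
  have hcongr : ∫ τ in (0:ℝ)..t, (p * w τ + b τ) = ∫ τ in (0:ℝ)..t, (p * z τ + b τ) := by
    refine intervalIntegral.integral_congr fun τ hτ => ?_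
    have h0 : (0:ℝ) ∈ Set.Icc (-T) T := ⟨by linarith, hT.le⟩
    simp only [hwz τ (Set.uIcc_subset_Icc h0 ht hτ)]
  rw [hcongr, hft, hz0, hwz t ht]
  ring

theorem sol_eq {s T : ℝ} (hs : 0 < s) (hT : 0 < T) (h : -T ≤ T) (u₀ : realSub)
    (U : C(Set.Icc (-T) T, realSub)) (hU : IsBBMSol s T u₀ U) (t : Set.Icc (-T) T) :
    U t = u₀ + ∫ τ in (0:ℝ)..t, (Amul (U (Set.projIcc (-T) T h τ)) +
      Bmul hs (U (Set.projIcc (-T) T h τ)) (U (Set.projIcc (-T) T h τ))) := by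
  have hcU := cont_ext h U
  have h0 : (0:ℝ) ∈ Set.Icc (-T) T := ⟨by linarith, hT.le⟩
  have key : ∀ k, ev k (U t) = ev k (u₀ + ∫ τ in (0:ℝ)..t, (Amul (U (Set.projIcc (-T) T h τ)) +
      Bmul hs (U (Set.projIcc (-T) T h τ)) (U (Set.projIcc (-T) T h τ)))) := by
    intro k
    have hcont : Continuous fun τ : ℝ => (Amul (U (Set.projIcc (-T) T h τ)) +
      Bmul hs (U (Set.projIcc (-T) T h τ)) (U (Set.projIcc (-T) T h τ))) := by fun_prop
    rw [map_add, ← ContinuousLinearMap.intervalIntegral_comp_comm _ (hcont.intervalIntegrable _ _)]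
    simp only [map_add, ev_Amul]
    have := scalar_duhamel (-I * (phiSymb k : ℂ))
      (fun τ => ev k (Bmul hs (U (Set.projIcc (-T) T h τ)) (U (Set.projIcc (-T) T h τ))))
      (fun τ => ev k (U (Set.projIcc (-T) T h τ))) (ev k u₀) (by fun_prop) hT ?_ t t.2
    · simpa only [Set.projIcc_val] using this
    · intro t ht
      have hsol := hU t ht k
      have hwp : (wt s k : ℂ) ≠ 0 := by exact_mod_cast (wt_pos s k).ne'
      have e1 : uc s T U t k = (wt s k : ℂ)⁻¹ * ev k (U (Set.projIcc (-T) T h t)) := by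
        rw [uc, dif_pos ht, coeffAt_eq, Set.projIcc_of_mem h ht, ev_apply]
        push_cast; rfl
      have e2 : ∀ τ ∈ Set.uIcc 0 t,
          Complex.exp (-Complex.I * (t - τ) * phiSymb k) * ((phiSymb k : ℝ) : ℂ) *
          ∑' l : ℤ, uc s T U τ l * uc s T U τ (k - l) =
          (wt s k : ℂ)⁻¹ * (2 * I) * (exp (-I * (phiSymb k : ℂ) * (t - τ)) *
            ev k (Bmul hs (U (Set.projIcc (-T) T h τ)) (U (Set.projIcc (-T) T h τ)))) := by
        intro τ hτ
        have hτ' := Set.uIcc_subset_Icc h0 ht hτ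
        have : ∑' l : ℤ, uc s T U τ l * uc s T U τ (k - l) =
            cv s (U (Set.projIcc (-T) T h τ)) (U (Set.projIcc (-T) T h τ)) k := by
          unfold cv
          refine tsum_congr fun l => ?_
          rw [uc, uc, dif_pos hτ', dif_pos hτ', Set.projIcc_of_mem h hτ']
        rw [this, ev_Bmul, bcf]
        have e3 : -I * (t - τ) * phiSymb k = -I * (phiSymb k : ℂ) * ((t:ℂ) - τ) := by ring
        rw [e3]
        field_simp
        linear_combination ((phiSymb k : ℂ) *
            cv s (U (Set.projIcc (-T) T h τ)) (U (Set.projIcc (-T) T h τ)) k) * I_sq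
      rw [intervalIntegral.integral_congr e2, intervalIntegral.integral_const_mul, e1,
        coeffAt_eq] at hsol
      have e3 : -I * (t:ℂ) * phiSymb k = -I * (phiSymb k : ℂ) * (t:ℂ) := by ring
      rw [e3, ← ev_apply] at hsol
      push_cast at hsol
      have := congrArg (fun x => (wt s k : ℂ) * x) hsol
      rw [mul_inv_cancel_left₀ hwp] at this
      rw [this]
      generalize (∫ x in (0:ℝ)..t, exp (-I * (phiSymb k : ℂ) * ((t:ℂ) - x)) *
            ev k (Bmul hs (U (Set.projIcc (-T) T h x)) (U (Set.projIcc (-T) T h x)))) = Q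
      generalize exp (-I * (phiSymb k : ℂ) * (t:ℂ)) = P
      field_simp
      linear_combination (-Q) * I_sq
  ext k
  exact key k

end Concrete

/-- Real-analyticity of the global flow map: for each `T > 0` and `s > 0`,
the flow map `Φ : H^s(𝕋) → X^s_T = C⁰([-T,T], H^s(𝕋))` of the BBM equation (which sends
every `u₀ ∈ H^s(𝕋)` to the solution `Φ u₀ ∈ X^s_T` of the BBM integral equation) is
real-analytic. -/
theorem flowMap_analytic
    (s T : ℝ) (hs : 0 < s) (hT : 0 < T)
    (Φ : realSub → C(Set.Icc (-T) T, realSub))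
    (hΦ : ∀ u₀ : realSub, IsBBMSol s T u₀ (Φ u₀)) :
    AnalyticOnNhd ℝ Φ Set.univ := by
  exact abstract_flow (by linarith) Amul (Bmul hs) Φ
    (fun u t => sol_eq hs hT (by linarith) u (Φ u) (hΦ u) t)

end BBMFlow
end
end
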